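/- arXiv:2109.00562 — 3 statements merged into one kernel-verified Lean document; each statement's English description precedes it below -/
import Mathlib

section
/- Let p, q, n be positive integers such that 1/(2q²) ≤ π - p/q ≤ 1/(10^n · q) and 10^n ≤ q. Let r be the remainder of 10^n·p upon division by q, i.e., 10^n·p = a·q + r with integers a ≥ 0 and 0 ≤ r < q. Then the fractional part of π·10^n satisfies r/q + 10^n/(2q²) ≤ {π·10^n} ≤ (r+1)/q. -/
open Real

/-- If `1/(2q²) ≤ π - p/q ≤ 1/(10^n·q)` with `10^n ≤ q`, and `10^n·p = a·q + r` with
`0 ≤ r < q`, then `r/q + 10^n/(2q²) ≤ {π·10^n} ≤ (r+1)/q`. -/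
theorem fract_pi_pow_ten_bounds_small
    (p q n : ℕ) (hp : 0 < p) (hq : 0 < q) (hn : 0 < n)
    (h1 : 1 / (2 * (q : ℝ) ^ 2) ≤ π - (p : ℝ) / q)
    (h2 : π - (p : ℝ) / q ≤ 1 / (10 ^ n * (q : ℝ)))
    (h3 : 10 ^ n ≤ q)
    (a r : ℕ) (har : 10 ^ n * p = a * q + r) (hr : r < q) :
    (r : ℝ) / q + 10 ^ n / (2 * (q : ℝ) ^ 2) ≤ Int.fract (π * 10 ^ n) ∧
    Int.fract (π * 10 ^ n) ≤ ((r : ℝ) + 1) / q := by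
  have hq' : (0 : ℝ) < q := by exact_mod_cast hq
  have ht : (0 : ℝ) < 10 ^ n := by positivity
  have har' : (10 : ℝ) ^ n * p = a * q + r := by exact_mod_cast har
  have hr' : (r : ℝ) + 1 ≤ q := by exact_mod_cast hr
  have hdecomp : π * 10 ^ n = a + r / q + 10 ^ n * (π - p / q) := by
    have : (10 : ℝ) ^ n * (p / q) = a + r / q := by
      field_simp
      linarith
    linear_combination this
  have hlower : (10 : ℝ) ^ n / (2 * (q : ℝ) ^ 2) ≤ 10 ^ n * (π - p / q) := by
    calc (10 : ℝ) ^ n / (2 * (q : ℝ) ^ 2) = 10 ^ n * (1 / (2 * (q : ℝ) ^ 2)) := by ring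
      _ ≤ _ := by gcongr
  have hupper : (10 : ℝ) ^ n * (π - p / q) ≤ 1 / q := by
    calc (10 : ℝ) ^ n * (π - p / q) ≤ 10 ^ n * (1 / (10 ^ n * (q : ℝ))) := by gcongr
      _ = 1 / q := by field_simp
  have hsum : ((r : ℝ) + 1) / q = r / q + 1 / q := add_div _ _ _
  have hle : ((r : ℝ) + 1) / q ≤ 1 := (div_le_one hq').2 hr'
  have hne : π * 10 ^ n ≠ a + 1 := by
    have hirr : Irrational (π * (10 ^ n : ℕ)) := irrational_pi.mul_natCast (by positivity)
    have := hirr.ne_nat (a + 1)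
    push_cast at this
    exact this
  have hlt : π * 10 ^ n < a + 1 := lt_of_le_of_ne (by linarith) hne
  have hnonneg : (0 : ℝ) ≤ r / q + 10 ^ n / (2 * (q : ℝ) ^ 2) := by positivity
  have hfloor : ⌊π * 10 ^ n⌋ = (a : ℤ) := by
    rw [Int.floor_eq_iff, Int.cast_natCast]
    exact ⟨by linarith, hlt⟩
  rw [Int.fract, hfloor, Int.cast_natCast]
  constructor <;> linarith
end

section
/- Let p, q, n be positive integers and let μ ≥ 2 be a real number such that 1/q^μ ≤ π - p/q ≤ 1/q² and 10^n ≥ q. Write p·10^n = a·q + r with integers a ≥ 0, 0 ≤ r < q, and write (p·q+1)·10^n = b·q² + s·q + c with integers b ≥ 0, 0 ≤ s < q, 0 ≤ c < q. Then a + r/q + 1/q^(μ-1) ≤ π·10^n ≤ b + s/q + c/q². -/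
open Real

/-- If `1/q^μ ≤ π - p/q ≤ 1/q²` with `μ ≥ 2` and `10^n ≥ q`, and
`p·10^n = a·q + r`, `(p·q+1)·10^n = b·q² + s·q + c` with `0 ≤ r, s, c < q`, then
`a + r/q + 1/q^(μ-1) ≤ π·10^n ≤ b + s/q + c/q²`. -/
theorem pi_pow_ten_bounds_large
    (p q n : ℕ) (hp : 0 < p) (hq : 0 < q) (hn : 0 < n)
    (μ : ℝ) (hμ : 2 ≤ μ)
    (h1 : 1 / (q : ℝ) ^ μ ≤ π - (p : ℝ) / q)
    (h2 : π - (p : ℝ) / q ≤ 1 / (q : ℝ) ^ 2)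
    (h3 : q ≤ 10 ^ n)
    (a r : ℕ) (har : p * 10 ^ n = a * q + r) (hr : r < q)
    (b s c : ℕ) (hbsc : (p * q + 1) * 10 ^ n = b * q ^ 2 + s * q + c)
    (hs : s < q) (hc : c < q) :
    (a : ℝ) + (r : ℝ) / q + 1 / (q : ℝ) ^ (μ - 1) ≤ π * 10 ^ n ∧
    π * 10 ^ n ≤ (b : ℝ) + (s : ℝ) / q + (c : ℝ) / (q : ℝ) ^ 2 := by
  have hq0 : (0 : ℝ) < q := by exact_mod_cast hq
  have h10 : (0 : ℝ) < 10 ^ n := by positivity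
  have hpow : (q : ℝ) ≤ 10 ^ n := by exact_mod_cast h3
  have harR : (p : ℝ) * 10 ^ n = a * q + r := by exact_mod_cast har
  have hbscR : ((p : ℝ) * q + 1) * 10 ^ n = b * q ^ 2 + s * q + c := by exact_mod_cast hbsc
  constructor
  · have hdiv : (a : ℝ) + r / q = p / q * 10 ^ n := by
      field_simp
      linarith
    have hscale : 1 / (q : ℝ) ^ (μ - 1) ≤ 1 / (q : ℝ) ^ μ * 10 ^ n := by
      rw [rpow_sub_one hq0.ne', one_div_div, div_mul_eq_mul_div, one_mul]
      gcongr
    calc (a : ℝ) + r / q + 1 / (q : ℝ) ^ (μ - 1)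
        ≤ p / q * 10 ^ n + 1 / (q : ℝ) ^ μ * 10 ^ n := by rw [hdiv]; gcongr
      _ = (p / q + 1 / (q : ℝ) ^ μ) * 10 ^ n := by ring
      _ ≤ π * 10 ^ n := by gcongr; linarith
  · calc π * 10 ^ n ≤ (p / q + 1 / (q : ℝ) ^ 2) * 10 ^ n := by gcongr; linarith
      _ = ((p : ℝ) * q + 1) * 10 ^ n / q ^ 2 := by field_simp
      _ = b + s / q + c / (q : ℝ) ^ 2 := by rw [hbscR]; field_simp
end

section
/- (Wall's criterion) A real number α is a normal number in base 10 if and only if the sequence (α·10^n), n ≥ 1, is uniformly distributed modulo 1. Precisely: writing the digits of α as a_i = ⌊α·10^i⌋ mod 10, the condition that for every k ≥ 1 and every block (d_1,...,d_k) ∈ {0,...,9}^k the natural density of n with a_{n+j} = d_j for 1 ≤ j ≤ k equals 10^{-k} holds if and only if for all 0 ≤ a < b ≤ 1, lim_{N→∞} #{1 ≤ n ≤ N : a ≤ {α·10^n} < b}/N = b - a. -/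
open Real Filter

/-- Natural density is the same whether one counts over `0, …, N - 1` or over `1, …, N`. -/
theorem tendsto_card_filter_Icc_one_div_iff (p : ℕ → Prop) [DecidablePred p]
    (c : ℝ) :
    Tendsto (fun N : ℕ => (((Finset.Icc 1 N).filter p).card : ℝ) / N) atTop (nhds c) ↔
      Tendsto (fun N : ℕ => (((Finset.range N).filter p).card : ℝ) / N) atTop (nhds c) := by
  have key : Tendsto (fun N : ℕ => (((Finset.Icc 1 N).filter p).card : ℝ) / N -
      (((Finset.range N).filter p).card : ℝ) / N) atTop (nhds 0) := by
    refine squeeze_zero_norm (fun N => ?_) tendsto_one_div_atTop_nhds_zero_nat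
    have h₁ : ((Finset.Icc 1 N).filter p).card ≤ ((Finset.range N).filter p).card + 1 := by
      refine (Finset.card_le_card ?_).trans (Finset.card_insert_le N _)
      intro n
      simp only [Finset.mem_filter, Finset.mem_Icc, Finset.mem_insert, Finset.mem_range]
      rintro ⟨⟨-, h⟩, hp⟩
      rcases h.eq_or_lt with h | h
      · exact Or.inl h
      · exact Or.inr ⟨h, hp⟩
    have h₂ : ((Finset.range N).filter p).card ≤ ((Finset.Icc 1 N).filter p).card + 1 := by
      refine (Finset.card_le_card ?_).trans (Finset.card_insert_le 0 _)
      intro n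
      simp only [Finset.mem_filter, Finset.mem_Icc, Finset.mem_insert, Finset.mem_range]
      rintro ⟨h, hp⟩
      rcases n.eq_zero_or_pos with h0 | h0
      · exact Or.inl h0
      · exact Or.inr ⟨⟨h0, h.le⟩, hp⟩
    rify at h₁ h₂
    rw [← sub_div, Real.norm_eq_abs, abs_div, Nat.abs_cast]
    gcongr
    rw [abs_le]
    constructor <;> linarith
  constructor
  · intro h
    simpa using h.sub key
  · intro h
    simpa using h.add key

/-- The decimal digits of `x` after the point, up to the `k`-th, are those of
`⌊fract x * 10 ^ k⌋`. -/
theorem floor_mul_ten_pow_emod_ten (x : ℝ) {k j : ℕ} (hj : j < k) :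
    ⌊x * 10 ^ (j + 1)⌋ % 10 = ((⌊Int.fract x * 10 ^ k⌋₊ / 10 ^ (k - (j + 1)) % 10 : ℕ) : ℤ) := by
  have h₁ : x * 10 ^ (j + 1) =
      Int.fract x * 10 ^ (j + 1) + ((⌊x⌋ * 10 ^ j * 10 : ℤ) : ℝ) := by
    conv_lhs => rw [← Int.fract_add_floor x]
    push_cast
    ring
  have h₂ : Int.fract x * 10 ^ (j + 1) =
      Int.fract x * 10 ^ k / ((10 ^ (k - (j + 1)) : ℕ) : ℝ) := by
    obtain ⟨i, rfl⟩ := Nat.exists_eq_add_of_lt hj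
    rw [show j + i + 1 - (j + 1) = i by omega]
    push_cast
    field_simp
    ring
  have h₃ : 0 ≤ Int.fract x * 10 ^ (j + 1) := by
    have := Int.fract_nonneg x
    positivity
  rw [h₁, Int.floor_add_intCast, Int.add_mul_emod_self_right,
    ← Int.natCast_floor_eq_floor h₃, h₂, Nat.floor_div_natCast]
  push_cast
  rfl

/-- The first `k` decimals of `x` spell out `m` exactly when `fract x` lies in
`[m / 10 ^ k, (m + 1) / 10 ^ k)`. -/
theorem forall_digit_eq_iff_fract_mem (x : ℝ) {k : ℕ} (m : Fin (10 ^ k)) :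
    (∀ j : Fin k, ⌊x * 10 ^ ((j : ℕ) + 1)⌋ % 10 =
        (((finFunctionFinEquiv.symm m j.rev : Fin 10) : ℕ) : ℤ)) ↔
      ((m : ℕ) : ℝ) / 10 ^ k ≤ Int.fract x ∧ Int.fract x < (((m : ℕ) : ℝ) + 1) / 10 ^ k := by
  have h0 : 0 ≤ Int.fract x * 10 ^ k := by
    have := Int.fract_nonneg x
    positivity
  have hlt : ⌊Int.fract x * 10 ^ k⌋₊ < 10 ^ k := by
    rw [Nat.floor_lt h0]
    push_cast
    exact mul_lt_of_lt_one_left (by positivity) (Int.fract_lt_one x)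
  have hdigit : ∀ j : Fin k, ⌊x * 10 ^ ((j : ℕ) + 1)⌋ % 10 =
      (((finFunctionFinEquiv.symm (⟨_, hlt⟩ : Fin (10 ^ k)) j.rev : Fin 10) : ℕ) : ℤ) := by
    intro j
    rw [floor_mul_ten_pow_emod_ten x j.isLt, finFunctionFinEquiv_symm_apply_val, Fin.val_rev]
  have hfloor : ⌊Int.fract x * 10 ^ k⌋₊ = (m : ℕ) ↔
      ((m : ℕ) : ℝ) / 10 ^ k ≤ Int.fract x ∧ Int.fract x < (((m : ℕ) : ℝ) + 1) / 10 ^ k := by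
    rw [Nat.floor_eq_iff h0, div_le_iff₀ (by positivity), lt_div_iff₀ (by positivity)]
  rw [← hfloor]
  constructor
  · intro h
    have : (⟨_, hlt⟩ : Fin (10 ^ k)) = m := by
      apply finFunctionFinEquiv.symm.injective
      funext j
      have := (hdigit j.rev).symm.trans (h j.rev)
      rw [Fin.rev_rev] at this
      exact Fin.ext (by exact_mod_cast this)
    exact congrArg Fin.val this
  · intro h j
    rw [hdigit j, show (⟨_, hlt⟩ : Fin (10 ^ k)) = m from Fin.ext h]

open scoped Classical in
/-- If every interval `[m / 10 ^ k, (m + 1) / 10 ^ k)` in `[0, 1)` receives the terms of `u` with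
density `1 / 10 ^ k`, then so does every `[0, p / 10 ^ k)` with density `p / 10 ^ k`. -/
theorem tendsto_card_lt_div_ten_pow {u : ℕ → ℝ} (hu : ∀ n, 0 ≤ u n) {k : ℕ}
    (h : ∀ m : ℕ, m < 10 ^ k → Tendsto (fun N : ℕ => (((Finset.range N).filter fun n =>
      (m : ℝ) / 10 ^ k ≤ u n ∧ u n < ((m : ℝ) + 1) / 10 ^ k).card : ℝ) / N)
      atTop (nhds (1 / 10 ^ k)))
    (p : ℕ) (hp : p ≤ 10 ^ k) :
    Tendsto (fun N : ℕ => (((Finset.range N).filter fun n => u n < (p : ℝ) / 10 ^ k).card : ℝ) / N)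
      atTop (nhds ((p : ℝ) / 10 ^ k)) := by
  induction p with
  | zero => simp [(hu _).not_gt]
  | succ p ih =>
    have := (ih (by omega)).add (h p (by omega))
    rw [← add_div] at this
    push_cast
    refine this.congr fun N => ?_
    rw [← add_div, ← Nat.cast_add, ← Finset.card_union_of_disjoint]
    · congr 3
      ext n
      have hle : (p : ℝ) / 10 ^ k ≤ ((p : ℝ) + 1) / 10 ^ k := by gcongr; linarith
      simp only [Finset.mem_union, Finset.mem_filter]
      constructor
      · rintro (⟨h₁, h₂⟩ | ⟨h₁, h₂, h₃⟩)
        · exact ⟨h₁, h₂.trans_le hle⟩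
        · exact ⟨h₁, h₃⟩
      · rintro ⟨h₁, h₂⟩
        rcases lt_or_ge (u n) ((p : ℝ) / 10 ^ k) with h₃ | h₃
        · exact Or.inl ⟨h₁, h₃⟩
        · exact Or.inr ⟨h₁, h₃, h₂⟩
    · rw [Finset.disjoint_filter]
      intro n _ h₁ h₂
      exact h₁.not_ge h₂.1

open scoped Classical in
/-- A sequence whose distribution function is correct at the decimal fractions of `[0, 1]` has the
correct distribution function on all of `[0, 1]`. -/
theorem tendsto_card_lt_of_forall_div_ten_pow {u : ℕ → ℝ}
    (h : ∀ k : ℕ, 1 ≤ k → ∀ p : ℕ, p ≤ 10 ^ k →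
      Tendsto (fun N : ℕ =>
        (((Finset.range N).filter fun n => u n < (p : ℝ) / 10 ^ k).card : ℝ) / N)
        atTop (nhds ((p : ℝ) / 10 ^ k)))
    {t : ℝ} (ht0 : 0 ≤ t) (ht1 : t ≤ 1) :
    Tendsto (fun N : ℕ => (((Finset.range N).filter fun n => u n < t).card : ℝ) / N)
      atTop (nhds t) := by
  have hmono : ∀ s r : ℝ, s ≤ r → ∀ N : ℕ,
      (((Finset.range N).filter fun n => u n < s).card : ℝ) / N ≤
        (((Finset.range N).filter fun n => u n < r).card : ℝ) / N := by
    intro s r hsr N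
    gcongr
  have hpow : ∀ ε : ℝ, 0 < ε → ∃ k : ℕ, 1 ≤ k ∧ 1 / (10 : ℝ) ^ k < ε := by
    intro ε hε
    obtain ⟨k, hk⟩ := exists_pow_lt_of_lt_one hε (by norm_num : (1 / 10 : ℝ) < 1)
    refine ⟨k + 1, by omega, lt_of_le_of_lt ?_ hk⟩
    rw [one_div_pow]
    gcongr <;> norm_num
  rw [tendsto_order]
  constructor
  · intro a ha
    obtain ⟨k, hk, hε⟩ := hpow (t - a) (by linarith)
    have h10 : (0 : ℝ) < 10 ^ k := by positivity
    have hle : (⌊t * 10 ^ k⌋₊ : ℝ) / 10 ^ k ≤ t := by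
      rw [div_le_iff₀ h10]
      exact Nat.floor_le (by positivity)
    have hlt : a < (⌊t * 10 ^ k⌋₊ : ℝ) / 10 ^ k := by
      have := Nat.lt_floor_add_one (t * 10 ^ k)
      rw [← lt_div_iff₀ h10, add_div] at this
      linarith
    have hp : ⌊t * 10 ^ k⌋₊ ≤ 10 ^ k := by
      have : (⌊t * 10 ^ k⌋₊ : ℝ) ≤ 10 ^ k := (div_le_one h10).1 (hle.trans ht1)
      exact_mod_cast this
    filter_upwards [(h k hk _ hp).eventually_const_lt hlt] with N hN
    exact hN.trans_le (hmono _ _ hle N)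
  · intro b hb
    obtain ⟨k, hk, hε⟩ := hpow (b - t) (by linarith)
    have h10 : (0 : ℝ) < 10 ^ k := by positivity
    have hle : t ≤ (⌈t * 10 ^ k⌉₊ : ℝ) / 10 ^ k := by
      rw [le_div_iff₀ h10]
      exact Nat.le_ceil _
    have hlt : (⌈t * 10 ^ k⌉₊ : ℝ) / 10 ^ k < b := by
      have := Nat.ceil_lt_add_one (a := t * 10 ^ k) (by positivity)
      rw [← div_lt_div_iff_of_pos_right h10, add_div, mul_div_cancel_right₀ _ h10.ne'] at this
      linarith
    have hp : ⌈t * 10 ^ k⌉₊ ≤ 10 ^ k := by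
      rw [Nat.ceil_le]
      push_cast
      exact mul_le_of_le_one_left h10.le ht1
    filter_upwards [(h k hk _ hp).eventually_lt_const hlt] with N hN
    exact (hmono _ _ hle N).trans_lt hN

open scoped Classical in
/-- The counting function of `[a, b)` is the difference of those of `(-∞, b)` and `(-∞, a)`. -/
theorem card_filter_le_and_lt (u : ℕ → ℝ) {a b : ℝ} (hab : a ≤ b) (s : Finset ℕ) :
    ((s.filter fun n => a ≤ u n ∧ u n < b).card : ℝ) =
      (s.filter fun n => u n < b).card - (s.filter fun n => u n < a).card := by
  rw [eq_sub_iff_add_eq, ← Nat.cast_add, ← Finset.card_union_of_disjoint]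
  · congr 2
    ext n
    simp only [Finset.mem_union, Finset.mem_filter]
    constructor
    · rintro (⟨h₁, -, h₂⟩ | ⟨h₁, h₂⟩)
      · exact ⟨h₁, h₂⟩
      · exact ⟨h₁, h₂.trans_le hab⟩
    · rintro ⟨h₁, h₂⟩
      rcases lt_or_ge (u n) a with h₃ | h₃
      · exact Or.inr ⟨h₁, h₃⟩
      · exact Or.inl ⟨h₁, h₃, h₂⟩
  · rw [Finset.disjoint_filter]
    intro n _ h₁ h₂
    exact h₂.not_ge h₁.1

open scoped Classical in
/-- Wall's criterion: a real number `α` is normal in base 10 (every block of `k` decimal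
digits `a i = ⌊α·10^i⌋ mod 10` occurs with natural density `1/10^k`) if and only if the
sequence `(α·10^n)`, `n ≥ 1`, is uniformly distributed modulo 1. -/
theorem wall_criterion (α : ℝ) :
    (∀ k : ℕ, 1 ≤ k → ∀ d : Fin k → ℕ, (∀ j, d j ≤ 9) →
      Tendsto
        (fun N : ℕ =>
          (((Finset.range N).filter fun n : ℕ =>
              ∀ j : Fin k, ⌊α * 10 ^ (n + (j : ℕ) + 1)⌋ % 10 = (d j : ℤ)).card : ℝ) / N)
        atTop (nhds (1 / 10 ^ k))) ↔
    (∀ a b : ℝ, 0 ≤ a → a < b → b ≤ 1 →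
      Tendsto
        (fun N : ℕ =>
          (((Finset.Icc 1 N).filter fun n : ℕ =>
              a ≤ Int.fract (α * 10 ^ n) ∧ Int.fract (α * 10 ^ n) < b).card : ℝ) / N)
        atTop (nhds (b - a))) := by
  have hpow : ∀ n j : ℕ, α * 10 ^ (n + j + 1) = α * 10 ^ n * 10 ^ (j + 1) := fun n j => by ring
  simp only [hpow]
  constructor
  · intro h a b ha hab hb
    rw [tendsto_card_filter_Icc_one_div_iff]
    have hu : ∀ t : ℝ, 0 ≤ t → t ≤ 1 → Tendsto (fun N : ℕ =>
        (((Finset.range N).filter fun n => Int.fract (α * 10 ^ n) < t).card : ℝ) / N)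
        atTop (nhds t) := by
      refine fun t ht0 ht1 => tendsto_card_lt_of_forall_div_ten_pow (fun k hk p hp =>
        tendsto_card_lt_div_ten_pow (fun n => Int.fract_nonneg _) (fun m hm => ?_) p hp) ht0 ht1
      have := h k hk (fun j => (finFunctionFinEquiv.symm (⟨m, hm⟩ : Fin (10 ^ k)) j.rev : Fin 10))
        (fun j => Nat.le_of_lt_succ (Fin.isLt _))
      simpa only [forall_digit_eq_iff_fract_mem] using this
    refine ((hu b (by linarith) hb).sub (hu a ha (by linarith))).congr fun N => ?_
    rw [card_filter_le_and_lt _ hab.le, sub_div]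
  · intro h k _ d hd
    obtain ⟨m, hm⟩ := (finFunctionFinEquiv (m := 10) (n := k)).symm.surjective
      fun j => ⟨d j.rev, Nat.lt_succ_of_le (hd _)⟩
    have hdm : ∀ j : Fin k, (d j : ℤ) =
        (((finFunctionFinEquiv.symm m j.rev : Fin 10) : ℕ) : ℤ) := fun j => by
      simp only [hm, Fin.rev_rev]
    simp only [hdm, forall_digit_eq_iff_fract_mem]
    have h10 : (0 : ℝ) < 10 ^ k := by positivity
    have hm1 : ((m : ℕ) : ℝ) + 1 ≤ 10 ^ k := by exact_mod_cast m.isLt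
    have := h (((m : ℕ) : ℝ) / 10 ^ k) ((((m : ℕ) : ℝ) + 1) / 10 ^ k) (by positivity)
      (by gcongr; linarith) ((div_le_one h10).2 hm1)
    rwa [← sub_div, add_sub_cancel_left, tendsto_card_filter_Icc_one_div_iff] at this
end
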